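/- arXiv:0801.2067 — 4 statements merged into one kernel-verified Lean document; each statement's English description precedes it below -/
import Mathlib

section
/- For any commutative ring R, the finitistic flat dimension is at most the finitistic projective dimension: FFD(R) ≤ FPD(R). -/
open CategoryTheory Opposite

noncomputable section

universe u

variable (R : Type u) [CommRing R]

/-- `ExtVanish R M N n` : the `n`-th Ext group `Ext^n_R(M, N)` vanishes. -/
def ExtVanish (M N : ModuleCat.{u} R) (n : ℕ) : Prop :=
  Subsingleton (((Ext R (ModuleCat.{u} R) n).obj (op M)).obj N)

/-- `TorVanish R M N n` : the `n`-th Tor group `Tor_n^R(M, N)` vanishes. -/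
def TorVanish (M N : ModuleCat.{u} R) (n : ℕ) : Prop :=
  Subsingleton (((Tor (ModuleCat.{u} R) n).obj M).obj N)

/-- `pdLE R M n` : the projective dimension of `M` is at most `n`. -/
def pdLE (M : ModuleCat.{u} R) (n : ℕ) : Prop :=
  ∀ N : ModuleCat.{u} R, ExtVanish R M N (n + 1)

/-- `idLE R M n` : the injective dimension of `M` is at most `n`. -/
def idLE (M : ModuleCat.{u} R) (n : ℕ) : Prop :=
  ∀ N : ModuleCat.{u} R, ExtVanish R N M (n + 1)

/-- `fdLE R M n` : the flat dimension of `M` is at most `n`. -/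
def fdLE (M : ModuleCat.{u} R) (n : ℕ) : Prop :=
  ∀ N : ModuleCat.{u} R, TorVanish R M N (n + 1)

/-- `cdLE R M n` : the cotorsion dimension of `M` is at most `n`, i.e.
`Ext^{n+1}_R(F, M) = 0` for every flat `R`-module `F`. -/
def cdLE (M : ModuleCat.{u} R) (n : ℕ) : Prop :=
  ∀ F : ModuleCat.{u} R, Module.Flat R F → ExtVanish R F M (n + 1)

/-- The projective dimension of a module, as an element of `ℕ∞`. -/
def pd (M : ModuleCat.{u} R) : ℕ∞ := sInf ((↑) '' {n : ℕ | pdLE R M n})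

/-- The injective dimension of a module, as an element of `ℕ∞`. -/
def injd (M : ModuleCat.{u} R) : ℕ∞ := sInf ((↑) '' {n : ℕ | idLE R M n})

/-- The flat dimension of a module, as an element of `ℕ∞`. -/
def fd (M : ModuleCat.{u} R) : ℕ∞ := sInf ((↑) '' {n : ℕ | fdLE R M n})

/-- The cotorsion dimension of a module, as an element of `ℕ∞`. -/
def cd (M : ModuleCat.{u} R) : ℕ∞ := sInf ((↑) '' {n : ℕ | cdLE R M n})

/-- The global dimension of a ring. -/
def gldim : ℕ∞ := ⨆ M : ModuleCat.{u} R, pd R M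

/-- The weak global dimension of a ring. -/
def wdim : ℕ∞ := ⨆ M : ModuleCat.{u} R, fd R M

/-- The global cotorsion dimension of a ring: the supremum of the projective
dimensions of all flat modules. -/
def cotD : ℕ∞ := ⨆ (M : ModuleCat.{u} R) (_ : Module.Flat R M), pd R M

/-- The finitistic projective dimension of a ring. -/
def FPD : ℕ∞ := sSup {d : ℕ∞ | d ≠ ⊤ ∧ ∃ M : ModuleCat.{u} R, pd R M = d}

/-- The finitistic flat dimension of a ring. -/
def FFD : ℕ∞ := sSup {d : ℕ∞ | d ≠ ⊤ ∧ ∃ M : ModuleCat.{u} R, fd R M = d}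

/-- The finitistic injective dimension of a ring. -/
def FID : ℕ∞ := sSup {d : ℕ∞ | d ≠ ⊤ ∧ ∃ M : ModuleCat.{u} R, injd R M = d}

/-- The finitistic cotorsion dimension of a ring. -/
def FCD : ℕ∞ := sSup {d : ℕ∞ | d ≠ ⊤ ∧ ∃ M : ModuleCat.{u} R, cd R M = d}

/-- `R` is `n`-perfect if every flat `R`-module has projective dimension at most `n`. -/
def IsNPerfect (n : ℕ) : Prop :=
  ∀ M : ModuleCat.{u} R, Module.Flat R M → pd R M ≤ n

end


section Bridge

universe u

variable {R : Type u} [CommRing R]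

lemma ffd_shortExact {A B C : Type u} [AddCommGroup A] [AddCommGroup B] [AddCommGroup C]
    [Module R A] [Module R B] [Module R C] (f : A →ₗ[R] B) (g : B →ₗ[R] C)
    (hf : Function.Injective f) (hg : Function.Surjective g) (hfg : Function.Exact f g) :
    (ShortComplex.mk (ModuleCat.ofHom f) (ModuleCat.ofHom g)
      (by ext x; exact hfg.apply_apply_eq_zero x)).ShortExact where
  exact := (ShortComplex.ShortExact.moduleCat_exact_iff_function_exact _).2 hfg
  mono_f := (ModuleCat.mono_iff_injective _).2 hf
  epi_g := (ModuleCat.epi_iff_surjective _).2 hg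

lemma ffd_extVanish_iff (M N : ModuleCat.{u} R) (n : ℕ) :
    ExtVanish R M N (n + 1) ↔ Subsingleton (Abelian.Ext M N (n + 1)) := by
  let P := ProjectiveResolution.of M
  have h1 : ExtVanish R M N (n + 1) ↔
      ∀ f : P.complex.X (n + 1) ⟶ N, P.complex.d (n + 2) (n + 1) ≫ f = 0 →
        ∃ g : P.complex.X n ⟶ N, P.complex.d (n + 1) n ≫ g = f := by
    unfold ExtVanish
    rw [← ModuleCat.isZero_iff_subsingleton]
    rw [(P.isoExt (n + 1) N).isZero_iff]
    rw [← HomologicalComplex.exactAt_iff_isZero_homology,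
      HomologicalComplex.exactAt_iff' _ n (n + 1) (n + 2) (by simp) (by simp),
      ShortComplex.moduleCat_exact_iff]
    rfl
  rw [h1]
  constructor
  · intro h
    refine subsingleton_of_forall_eq 0 fun α => ?_
    obtain ⟨f, hf, rfl⟩ := P.extMk_surjective α (n + 2) rfl
    rw [P.extMk_eq_zero_iff f (n + 2) rfl hf n rfl]
    exact h f hf
  · intro h f hf
    rw [← P.extMk_eq_zero_iff f (n + 2) rfl hf n rfl]
    subsingleton

lemma ffd_pdLE_iff (M : ModuleCat.{u} R) (n : ℕ) :
    pdLE R M n ↔ HasProjectiveDimensionLE M n := by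
  unfold pdLE
  simp only [ffd_extVanish_iff]
  constructor
  · intro h
    exact hasProjectiveDimensionLT_of_enoughInjectives M (n + 1) h
  · intro h N
    exact HasProjectiveDimensionLT.subsingleton M (n + 1) (n + 1) le_rfl N

/-- Lifting property of `X` against `g`. -/
def FfdLift {I J : Type u} [AddCommGroup I] [AddCommGroup J] [Module R I] [Module R J]
    (g : I →ₗ[R] J) (X : Type u) [AddCommGroup X] [Module R X] : Prop :=
  ∀ h : X →ₗ[R] J, ∃ f : X →ₗ[R] I, g ∘ₗ f = h

lemma ffd_exists_lift (n : ℕ) : ∀ N : ModuleCat.{u} R, ∃ (I J : ModuleCat.{u} R) (g : I ⟶ J),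
    Injective I ∧ ∀ X : ModuleCat.{u} R, Subsingleton (Abelian.Ext X N (n + 1)) ↔
      FfdLift (R := R) g.hom X := by
  induction n with
  | zero =>
    intro N
    let ⟨p⟩ := EnoughInjectives.presentation N
    have h : (ShortComplex.mk _ _ (Limits.cokernel.condition p.f)).ShortExact :=
      { exact := ShortComplex.exact_cokernel p.f }
    refine ⟨p.J, Limits.cokernel p.f, Limits.cokernel.π p.f, p.injective, fun X => ?_⟩
    constructor
    · intro hs k
      obtain ⟨x, hx⟩ := Abelian.Ext.covariant_sequence_exact₃ X h
        (Abelian.Ext.mk₀ (ModuleCat.ofHom k)) (n₁ := 1) rfl (by subsingleton)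
      obtain ⟨y, rfl⟩ := (Abelian.Ext.mk₀_bijective _ _).2 x
      rw [Abelian.Ext.mk₀_comp_mk₀] at hx
      have := (Abelian.Ext.mk₀_bijective _ _).1 hx
      exact ⟨y.hom, by simpa using congrArg ModuleCat.Hom.hom this⟩
    · intro hl
      refine subsingleton_of_forall_eq 0 fun e => ?_
      obtain ⟨x, rfl⟩ := Abelian.Ext.covariant_sequence_exact₁ X h e
        (by apply Abelian.Ext.eq_zero_of_injective) (n₀ := 0) rfl
      obtain ⟨y, rfl⟩ := (Abelian.Ext.mk₀_bijective _ _).2 x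
      obtain ⟨f, hf⟩ := hl y.hom
      have : y = ModuleCat.ofHom f ≫ Limits.cokernel.π p.f := by
        ext1; exact hf.symm
      rw [this, ← Abelian.Ext.mk₀_comp_mk₀]
      rw [Abelian.Ext.comp_assoc_of_second_deg_zero]
      erw [h.comp_extClass]
      simp
  | succ n ih =>
    intro N
    let ⟨p⟩ := EnoughInjectives.presentation N
    have h : (ShortComplex.mk _ _ (Limits.cokernel.condition p.f)).ShortExact :=
      { exact := ShortComplex.exact_cokernel p.f }
    obtain ⟨I, J, g, hI, H⟩ := ih (Limits.cokernel p.f)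
    refine ⟨I, J, g, hI, fun X => ?_⟩
    rw [← H]
    have := p.injective
    constructor
    · intro hs
      refine subsingleton_of_forall_eq 0 fun e => ?_
      obtain ⟨x, rfl⟩ := Abelian.Ext.covariant_sequence_exact₃ X h e (n₁ := n + 2) rfl
        (by subsingleton)
      rw [Abelian.Ext.eq_zero_of_injective x]
      simp
    · intro hs
      refine subsingleton_of_forall_eq 0 fun e => ?_
      obtain ⟨x, rfl⟩ := Abelian.Ext.covariant_sequence_exact₁ X h e
        (by apply Abelian.Ext.eq_zero_of_injective) (n₀ := n + 1) rfl
      have : x = 0 := by subsingleton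
      simp [this]

end Bridge

section TorBridge

universe u

variable {R : Type u} [CommRing R]

open MonoidalCategory TensorProduct

lemma ffd_torVanish_iff (M N : ModuleCat.{u} R) (P : ProjectiveResolution N) (n : ℕ) :
    TorVanish R M N (n + 1) ↔
      Function.Exact ((P.complex.d (n + 2) (n + 1)).hom.lTensor M)
        ((P.complex.d (n + 1) n).hom.lTensor M) := by
  unfold TorVanish
  rw [← ModuleCat.isZero_iff_subsingleton]
  erw [(P.isoLeftDerivedObj ((tensoringLeft (ModuleCat.{u} R)).obj M) (n + 1)).isZero_iff]
  erw [← HomologicalComplex.exactAt_iff_isZero_homology]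
  rw [HomologicalComplex.exactAt_iff' _ (n + 2) (n + 1) n (by simp) (by simp),
      ShortComplex.ShortExact.moduleCat_exact_iff_function_exact]
  rfl

lemma ffd_res_exact (N : ModuleCat.{u} R) (P : ProjectiveResolution N) (n : ℕ) :
    Function.Exact (P.complex.d (n + 2) (n + 1)).hom (P.complex.d (n + 1) n).hom := by
  have := P.complex_exactAt_succ n
  rw [HomologicalComplex.exactAt_iff' _ (n + 2) (n + 1) n (by simp) (by simp),
      ShortComplex.ShortExact.moduleCat_exact_iff_function_exact] at this
  exact this

lemma ffd_res_exact₀ (N : ModuleCat.{u} R) (P : ProjectiveResolution N) :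
    Function.Exact (P.complex.d 1 0).hom (P.π.f 0).hom := by
  have := P.exact₀
  rw [ShortComplex.ShortExact.moduleCat_exact_iff_function_exact] at this
  exact this

lemma ffd_tor_of_flat (M N : ModuleCat.{u} R) [Module.Flat R M] (n : ℕ) :
    TorVanish R M N (n + 1) := by
  rw [ffd_torVanish_iff M N (ProjectiveResolution.of N) n]
  exact Module.Flat.lTensor_exact M (ffd_res_exact _ _ _)

/-- dimension shifting for Tor -/
lemma ffd_tor_shift (A B C N : ModuleCat.{u} R) (f : A →ₗ[R] B) (g : B →ₗ[R] C)
    (hf : Function.Injective f) (hg : Function.Surjective g) (hfg : Function.Exact f g)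
    [Module.Flat R B] (n : ℕ) :
    TorVanish R C N (n + 2) ↔ TorVanish R A N (n + 1) := by
  let P := ProjectiveResolution.of N
  have hP : ∀ i, Module.Flat R (P.complex.X i) := fun i => by
    have : Module.Projective R (P.complex.X i) :=
      (IsProjective.iff_projective (R := R) (P := P.complex.X i)).2 (P.projective i)
    infer_instance
  rw [ffd_torVanish_iff C N P, ffd_torVanish_iff A N P]
  have eB := fun i => Module.Flat.lTensor_exact B (ffd_res_exact N P i)
  have fi : ∀ i, Function.Injective (f.rTensor (P.complex.X i)) := fun i =>
    Module.Flat.rTensor_preserves_injective_linearMap f hf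
  have gs : ∀ i, Function.Surjective (g.rTensor (P.complex.X i)) := fun i =>
    LinearMap.rTensor_surjective _ hg
  have ex : ∀ i, Function.Exact (f.rTensor (P.complex.X i)) (g.rTensor (P.complex.X i)) := fun i =>
    rTensor_exact _ hfg hg
  have dd : ∀ (M : ModuleCat.{u} R) i (x : M ⊗[R] P.complex.X (i+2)),
      ((P.complex.d (i + 1) i).hom.lTensor M) ((P.complex.d (i + 2) (i + 1)).hom.lTensor M x) = 0 := by
    intro M i x
    rw [← LinearMap.comp_apply, ← LinearMap.lTensor_comp]
    have : (P.complex.d (i + 1) i).hom ∘ₗ (P.complex.d (i + 2) (i + 1)).hom = 0 := by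
      rw [← ModuleCat.hom_comp]; simp
    rw [this]; simp
  have cf : ∀ i (x : A ⊗[R] P.complex.X (i+1)),
      f.rTensor _ ((P.complex.d (i + 1) i).hom.lTensor A x) =
      (P.complex.d (i + 1) i).hom.lTensor B (f.rTensor _ x) := by
    intro i x
    rw [← LinearMap.comp_apply, ← LinearMap.comp_apply, LinearMap.rTensor_comp_lTensor,
      LinearMap.lTensor_comp_rTensor]
  have cg : ∀ i (x : B ⊗[R] P.complex.X (i+1)),
      g.rTensor _ ((P.complex.d (i + 1) i).hom.lTensor B x) =
      (P.complex.d (i + 1) i).hom.lTensor C (g.rTensor _ x) := by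
    intro i x
    rw [← LinearMap.comp_apply, ← LinearMap.comp_apply, LinearMap.rTensor_comp_lTensor,
      LinearMap.lTensor_comp_rTensor]
  constructor
  · intro h a
    constructor
    · intro ha
      -- a : A ⊗ P (n+1), d a = 0
      obtain ⟨b, hb⟩ := (eB n (f.rTensor _ a)).1 (by rw [← cf, ha, map_zero])
      obtain ⟨c, hc⟩ := (h (g.rTensor _ b)).1 (by
        rw [← cg, hb]; exact (ex _).apply_apply_eq_zero a)
      obtain ⟨b', rfl⟩ := gs _ c
      rw [← cg] at hc
      obtain ⟨a', ha'⟩ := (ex _ (b - (P.complex.d (n + 3) (n + 2)).hom.lTensor B b')).1 (by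
        rw [map_sub, hc, sub_self])
      refine ⟨a', fi _ ?_⟩
      rw [cf, ha', map_sub, hb, dd, sub_zero]
    · rintro ⟨a', rfl⟩
      exact dd _ _ _
  · intro h c
    constructor
    · intro hc
      obtain ⟨b, rfl⟩ := gs _ c
      rw [← cg] at hc
      obtain ⟨a, ha⟩ := (ex _ _).1 hc
      obtain ⟨a', rfl⟩ := (h a).1 (fi _ (by rw [cf, ha, dd, map_zero]))
      rw [cf] at ha
      obtain ⟨b', hb'⟩ := (eB (n+1) (b - f.rTensor _ a')).1 (by rw [map_sub, ha, sub_self])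
      refine ⟨g.rTensor _ b', ?_⟩
      rw [← cg, hb', map_sub, (ex _).apply_apply_eq_zero a', sub_zero]
    · rintro ⟨a', rfl⟩
      exact dd _ _ _

lemma ffd_flat_of_tor (M : ModuleCat.{u} R) (h : ∀ N, TorVanish R M N 1) : Module.Flat R M := by
  rw [Module.Flat.iff_lTensor_preserves_injective_linearMap]
  intro A B _ _ _ _ j hj
  let N : ModuleCat.{u} R := ModuleCat.of R (B ⧸ LinearMap.range j)
  let P := ProjectiveResolution.of N
  have hE := (ffd_torVanish_iff M N P 0).1 (h N)
  have e0 := ffd_res_exact₀ N P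
  have e1 := ffd_res_exact N P 0
  have : Module.Projective R (P.complex.X 0) :=
      (IsProjective.iff_projective (R := R) (P := P.complex.X 0)).2 (P.projective 0)
  set d1 : P.complex.X 1 →ₗ[R] P.complex.X 0 := (P.complex.d 1 0).hom with hd1
  set d2 : P.complex.X 2 →ₗ[R] P.complex.X 1 := (P.complex.d 2 1).hom with hd2
  let p : P.complex.X 0 →ₗ[R] (B ⧸ LinearMap.range j) := (P.π.f 0).hom
  have hp : Function.Surjective p :=
    (ModuleCat.epi_iff_surjective _).1 (inferInstanceAs (Epi (P.π.f 0)))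
  have e0' : Function.Exact d1 p := e0
  obtain ⟨q, hq⟩ := Module.projective_lifting_property (LinearMap.range j).mkQ p
    (Submodule.mkQ_surjective _)
  -- the map P1 → A
  have hr : ∀ x, q (d1 x) ∈ LinearMap.range j := by
    intro x
    rw [← Submodule.Quotient.mk_eq_zero, ← Submodule.mkQ_apply, ← LinearMap.comp_apply, hq]
    exact e0'.apply_apply_eq_zero x
  let je := LinearEquiv.ofInjective j hj
  let r : P.complex.X 1 →ₗ[R] A := je.symm.toLinearMap ∘ₗ (q ∘ₗ d1).codRestrict _ hr
  have hjr : ∀ x, j (r x) = q (d1 x) := by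
    intro x
    have : (je (r x) : B) = q (d1 x) := by simp [r]
    exact this
  -- exactness of P1 → A × P0 → B → 0
  let s : P.complex.X 1 →ₗ[R] A × P.complex.X 0 := r.prod d1
  let t : A × P.complex.X 0 →ₗ[R] B := j.coprod (-q)
  have hst : Function.Exact s t := by
    rintro ⟨a, y⟩
    constructor
    · intro hay
      have hay : j a = q y := by simpa [t, ← sub_eq_add_neg, sub_eq_zero] using hay
      obtain ⟨x, hx⟩ := (e0' y).1 (by
        rw [← hq, LinearMap.comp_apply, ← hay]; simp)
      refine ⟨x, ?_⟩
      have : r x = a := hj (by rw [hjr, hx, hay])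
      simp [s, this, hx]
    · rintro ⟨x, hx⟩
      have h1 : r x = a := congrArg Prod.fst hx
      have h2 : d1 x = y := congrArg Prod.snd hx
      simp [t, ← h1, ← h2, hjr]
  have ht : Function.Surjective t := by
    intro b
    obtain ⟨y, hy⟩ := hp (-(LinearMap.range j).mkQ b)
    have : b + q y ∈ LinearMap.range j := by
      rw [← Submodule.Quotient.mk_eq_zero, ← Submodule.mkQ_apply, map_add,
        ← LinearMap.comp_apply _ q, hq, hy]; simp
    obtain ⟨a, ha⟩ := this
    exact ⟨(a, y), by simp [t, ha]⟩
  have hT := lTensor_exact M hst ht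
  rw [injective_iff_map_eq_zero]
  intro x hx
  obtain ⟨z, hz⟩ := (hT ((LinearMap.inl R A (P.complex.X 0)).lTensor M x)).1 (by
    rw [← LinearMap.comp_apply, ← LinearMap.lTensor_comp]
    simpa [t] using hx)
  have h1 : d1.lTensor M z = 0 := by
    have : d1 = LinearMap.snd R A (P.complex.X 0) ∘ₗ s := by ext; simp [s]
    rw [this, LinearMap.lTensor_comp, LinearMap.comp_apply, hz, ← LinearMap.comp_apply,
      ← LinearMap.lTensor_comp]
    simp
  obtain ⟨w, rfl⟩ := (hE z).1 h1
  have h2 : x = r.lTensor M (d2.lTensor M w) := by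
    have : r = LinearMap.fst R A (P.complex.X 0) ∘ₗ s := by ext; simp [s]
    rw [this, LinearMap.lTensor_comp, LinearMap.comp_apply, hz, ← LinearMap.comp_apply,
      ← LinearMap.lTensor_comp]
    simp
  have h3 : r ∘ₗ d2 = 0 := by
    ext y
    apply hj
    have : d1 (d2 y) = 0 := e1.apply_apply_eq_zero y
    simp [hjr, this]
  rw [h2, ← LinearMap.comp_apply, ← LinearMap.lTensor_comp, h3]
  simp

/-- If all flats have projective dimension `≤ n`, finite flat dimension gives finite
projective dimension. -/
lemma ffd_pd_of_fd (n : ℕ)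
    (hflat : ∀ F : ModuleCat.{u} R, Module.Flat R F → HasProjectiveDimensionLE F n) (m : ℕ) :
    ∀ M : ModuleCat.{u} R, fdLE R M m → HasProjectiveDimensionLE M (n + m) := by
  induction m with
  | zero => exact fun M h => hflat M (ffd_flat_of_tor M h)
  | succ m ih =>
    intro M h
    let g : (M →₀ R) →ₗ[R] M := Finsupp.linearCombination R id
    have hg : Function.Surjective g := Finsupp.linearCombination_id_surjective R M
    have hS := ffd_shortExact (A := g.ker) (B := M →₀ R) (C := M) g.ker.subtype g g.ker.injective_subtype hg
      (LinearMap.exact_subtype_ker_map g)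
    have h1 := ih (ModuleCat.of R g.ker) (fun N =>
      (ffd_tor_shift (ModuleCat.of R g.ker) (ModuleCat.of R (M →₀ R)) M N g.ker.subtype g
        g.ker.injective_subtype hg (LinearMap.exact_subtype_ker_map g) m).1 (h N))
    have : Projective (ModuleCat.of R (M →₀ R)) :=
      (IsProjective.iff_projective (R := R) (P := (M →₀ R))).1 inferInstance
    exact hS.hasProjectiveDimensionLT_X₃ (n + m + 1) h1
      (inferInstanceAs (HasProjectiveDimensionLT (ModuleCat.of R (M →₀ R)) (n + m + 1 + 1)))

lemma ffd_fd_of_pd (m : ℕ) :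
    ∀ M : ModuleCat.{u} R, HasProjectiveDimensionLE M m → fdLE R M m := by
  induction m with
  | zero =>
    intro M h N
    have h1 := (projective_iff_hasProjectiveDimensionLE_zero M).2 h
    have : Module.Projective R M := (IsProjective.iff_projective (R := R) (P := M)).2 h1
    exact ffd_tor_of_flat M N 0
  | succ m ih =>
    intro M h N
    let g : (M →₀ R) →ₗ[R] M := Finsupp.linearCombination R id
    have hg : Function.Surjective g := Finsupp.linearCombination_id_surjective R M
    have hS := ffd_shortExact (A := g.ker) (B := M →₀ R) (C := M) g.ker.subtype g g.ker.injective_subtype hg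
      (LinearMap.exact_subtype_ker_map g)
    have : Projective (ModuleCat.of R (M →₀ R)) :=
      (IsProjective.iff_projective (R := R) (P := (M →₀ R))).1 inferInstance
    have h1 := hS.hasProjectiveDimensionLT_X₁ (m + 1)
      (inferInstanceAs (HasProjectiveDimensionLT (ModuleCat.of R (M →₀ R)) (m + 1))) h
    exact (ffd_tor_shift (ModuleCat.of R g.ker) (ModuleCat.of R (M →₀ R)) M N g.ker.subtype g
        g.ker.injective_subtype hg (LinearMap.exact_subtype_ker_map g) m).2 (ih _ h1 N)

end TorBridge

section Comb

universe u

/-- `Y` is closed under the finitary operation `G`. -/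
def FfdClosed {K : Type u} (G : Finset K → Finset K) (Y : Set K) : Prop :=
  ∀ S : Finset K, (S : Set K) ⊆ Y → (G S : Set K) ⊆ Y

/-- The closure of `X` under `G`. -/
def ffdCl {K : Type u} (G : Finset K → Finset K) (X : Set K) : Set K :=
  ⋂₀ {Y | X ⊆ Y ∧ FfdClosed G Y}

variable {K : Type u} (G : Finset K → Finset K)

lemma ffdCl_closed (X : Set K) : FfdClosed G (ffdCl G X) := by
  intro S hS
  refine Set.subset_sInter fun Y hY => ?_
  exact hY.2 S (hS.trans (Set.sInter_subset_of_mem hY))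

lemma subset_ffdCl (X : Set K) : X ⊆ ffdCl G X := Set.subset_sInter fun _ hY => hY.1

variable {G} in
lemma ffdCl_subset {X Y : Set K} (h : X ⊆ Y) (hY : FfdClosed G Y) : ffdCl G X ⊆ Y :=
  Set.sInter_subset_of_mem ⟨h, hY⟩

lemma ffdCl_mono {X Y : Set K} (h : X ⊆ Y) : ffdCl G X ⊆ ffdCl G Y :=
  ffdCl_subset (h.trans (subset_ffdCl G Y)) (ffdCl_closed G Y)

open Cardinal in
lemma ffdCl_card (X : Set K) : #(ffdCl G X) ≤ max ℵ₀ #X := by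
  classical
  set κ := max ℵ₀ #X with hκ
  have hκ0 : ℵ₀ ≤ κ := le_max_left _ _
  let step : Set K → Set K := fun Z =>
    Z ∪ ⋃ S : Finset Z, (G (S.map (Function.Embedding.subtype _)) : Set K)
  have hstep : ∀ Z : Set K, #Z ≤ κ → #(step Z) ≤ κ := by
    intro Z hZ
    have hfin : #(Finset Z) ≤ κ := by
      rcases finite_or_infinite Z with h | h
      · exact (Cardinal.lt_aleph0_of_finite _).le.trans hκ0
      · rw [Cardinal.mk_finset_of_infinite]; exact hZ
    refine (Cardinal.mk_union_le _ _).trans (Cardinal.add_le_of_le hκ0 hZ ?_)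
    refine (Cardinal.mk_iUnion_le_sum_mk).trans ?_
    refine (Cardinal.sum_le_sum _ (fun _ => κ) fun S => ?_).trans ?_
    · exact (Cardinal.lt_aleph0_of_finite _).le.trans hκ0
    · rw [Cardinal.sum_const']
      exact Cardinal.mul_le_of_le hκ0 hfin le_rfl
  let Z : ℕ → Set K := fun i => step^[i] X
  have hZs : ∀ i, Z (i + 1) = step (Z i) := fun i => Function.iterate_succ_apply' _ _ _
  have hZ : ∀ i, #(Z i) ≤ κ := by
    intro i
    induction i with
    | zero => exact le_max_right _ _
    | succ i ih => rw [hZs]; exact hstep _ ih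
  have hmono : Monotone Z := monotone_nat_of_le_succ fun i => by
    rw [hZs]; exact Set.subset_union_left
  have hcl : FfdClosed G (⋃ i, Z i) := by
    intro S hS
    have : ∃ i, (S : Set K) ⊆ Z i := by
      have := (hmono.directed_le).exists_mem_subset_of_finset_subset_biUnion hS
      exact this
    obtain ⟨i, hi⟩ := this
    refine Set.Subset.trans ?_ (Set.subset_iUnion Z (i + 1))
    rw [hZs]
    refine Set.Subset.trans ?_ Set.subset_union_right
    have : (Finset.map (Function.Embedding.subtype (· ∈ Z i)) (S.subtype (· ∈ Z i))) = S :=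
      Finset.subtype_map_of_mem fun x hx => hi hx
    refine Set.Subset.trans ?_ (Set.subset_iUnion _ (S.subtype (· ∈ Z i)))
    erw [this]
  refine (Cardinal.mk_le_mk_of_subset (ffdCl_subset (Set.subset_iUnion Z 0) hcl)).trans ?_
  have h0 := Cardinal.mk_iUnion_le_sum_mk_lift (f := Z)
  rw [Cardinal.lift_uzero] at h0
  refine h0.trans ?_
  have h1 : Cardinal.sum (fun i => #(Z i)) ≤ Cardinal.sum (fun _ : ℕ => κ) :=
    Cardinal.sum_le_sum _ _ hZ
  refine h1.trans ?_
  rw [Cardinal.sum_const]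
  simpa using Cardinal.mul_le_of_le hκ0 hκ0 (le_refl κ)

lemma ffdCl_sUnion (hG : G ∅ = ∅) {T : Type u} [LinearOrder T] (e : T → K)
    (c : Set (LowerSet T)) :
    ffdCl G (e '' ((sSup c : LowerSet T) : Set T)) ⊆ ⋃ D ∈ c, ffdCl G (e '' (D : Set T)) := by
  apply ffdCl_subset
  · rintro _ ⟨t, ht, rfl⟩
    simp only [LowerSet.coe_sSup, Set.mem_iUnion] at ht
    obtain ⟨D, hD, ht⟩ := ht
    simp only [Set.mem_iUnion]
    exact ⟨D, hD, subset_ffdCl _ _ ⟨t, ht, rfl⟩⟩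
  · intro S hS
    rcases S.eq_empty_or_nonempty with rfl | hne
    · simp [hG]
    · obtain ⟨s, hs⟩ := hne
      have hc : c.Nonempty := by
        have := hS hs
        simp only [Set.mem_iUnion] at this
        exact ⟨this.choose, this.choose_spec.choose⟩
      obtain ⟨D, hD, h⟩ := DirectedOn.exists_mem_subset_of_finset_subset_biUnion hc
        (f := fun D : LowerSet T => ffdCl G (e '' (D : Set T))) (by
          intro D hD E hE
          rcases le_total D E with h | h
          · exact ⟨E, hE, ffdCl_mono _ (Set.image_mono h), subset_rfl⟩
          · exact ⟨D, hD, subset_rfl, ffdCl_mono _ (Set.image_mono h)⟩) hS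
      exact (ffdCl_closed G _ S h).trans (Set.subset_biUnion_of_mem (u := fun D : LowerSet T => ffdCl G (e '' (D : Set T))) hD)

end Comb

section Eklof

universe u

variable {R : Type u} [CommRing R] {K : Type u} [AddCommGroup K] [Module R K]

lemma ffd_eklof {I J : Type u} [AddCommGroup I] [AddCommGroup J] [Module R I] [Module R J]
    (g : I →ₗ[R] J) (hI : Module.Injective R I) {T : Type u} [LinearOrder T] [WellFoundedLT T]
    (L : LowerSet T → Submodule R K) (hL : Monotone L)
    (hcont : ∀ c : Set (LowerSet T), L (sSup c) ≤ ⨆ D ∈ c, L D)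
    (hstep : ∀ a : T, FfdLift g
      (L (LowerSet.Iic a) ⧸ (L (LowerSet.Iio a)).submoduleOf (L (LowerSet.Iic a)))) :
    FfdLift g (L ⊤) := by
  intro h
  have hcont' : ∀ c : Set (LowerSet T), L (sSup c) = ⨆ D ∈ c, L D := fun c =>
    le_antisymm (hcont c) (iSup₂_le fun D hD => hL (le_sSup hD))
  let 𝒮 : Set (K →ₗ.[R] I) := {f | (∃ D, f.domain = L D) ∧
    ∀ x (hx : x ∈ f.domain) (hx' : x ∈ L ⊤), g (f ⟨x, hx⟩) = h ⟨x, hx'⟩}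
  obtain ⟨m, hm⟩ : ∃ m, Maximal (· ∈ 𝒮) m := by
    apply zorn_le₀
    intro c hc hchain
    have hd : DirectedOn (· ≤ ·) c := hchain.directedOn
    refine ⟨LinearPMap.sSup c hd, ⟨⟨sSup {D | ∃ f ∈ c, f.domain = L D}, ?_⟩, ?_⟩,
      fun z hz => LinearPMap.le_sSup hd hz⟩
    · rw [LinearPMap.domain_sSup, hcont']
      apply le_antisymm
      · apply sSup_le
        rintro _ ⟨f, hf, rfl⟩
        obtain ⟨D, hD⟩ := (hc hf).1
        rw [hD]
        exact le_iSup₂_of_le D ⟨f, hf, hD⟩ le_rfl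
      · apply iSup₂_le
        rintro D ⟨f, hf, hD⟩
        rw [← hD]
        exact le_sSup ⟨f, hf, rfl⟩
    · intro x hx hx'
      rcases c.eq_empty_or_nonempty with rfl | hne
      · have : x = 0 := by
          rw [LinearPMap.domain_sSup] at hx
          simpa using hx
        subst this
        have h1 : (⟨0, hx⟩ : (LinearPMap.sSup ∅ hd : K →ₗ.[R] I).domain) = 0 := rfl
        have h2 : (⟨0, hx'⟩ : L ⊤) = 0 := rfl
        rw [h1, h2, LinearPMap.map_zero, map_zero, map_zero]
      · obtain ⟨f, hf, hxf⟩ := (LinearPMap.mem_domain_sSup_iff hne hd).1 hx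
        rw [← (hc hf).2 x hxf hx']
        congr 1
        exact LinearPMap.sSup_apply hd hf ⟨x, hxf⟩
  have hmS : m ∈ 𝒮 := hm.prop
  let D : LowerSet T := sSup {D | L D ≤ m.domain}
  have hD : m.domain = L D := by
    apply le_antisymm
    · obtain ⟨D0, h0⟩ := hmS.1
      rw [h0]
      exact hL (le_sSup h0.ge)
    · refine (hcont _).trans (iSup₂_le fun D hD => hD)
  by_cases hDtop : D = ⊤
  · rw [hDtop] at hD
    have hle : L ⊤ ≤ m.domain := hD.ge
    refine ⟨m.toFun ∘ₗ Submodule.inclusion hle, ?_⟩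
    ext x
    exact hmS.2 x.1 (hle x.2) x.2
  · exfalso
    have hex : {a : T | a ∉ D}.Nonempty := by
      by_contra hcon
      rw [Set.not_nonempty_iff_eq_empty] at hcon
      apply hDtop
      ext a
      simp only [LowerSet.coe_top, Set.mem_univ, iff_true]
      by_contra ha
      have : a ∈ {a : T | a ∉ D} := ha
      rw [hcon] at this
      exact this
    obtain ⟨a, ha, hmin⟩ := WellFounded.has_min (wellFounded_lt (α := T)) _ hex
    have hDa : D = LowerSet.Iio a := by
      ext x
      simp only [SetLike.mem_coe, LowerSet.mem_Iio_iff]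
      constructor
      · intro hx
        by_contra hax
        exact ha (D.lower (not_lt.1 hax) hx)
      · intro hx
        by_contra hxD
        exact hmin x hxD hx
    rw [hDa] at hD
    set A := L (LowerSet.Iio a) with hA
    set B := L (LowerSet.Iic a) with hB
    have hAB : A ≤ B := hL (fun x hx => le_of_lt hx)
    have hBt : B ≤ L ⊤ := hL le_top
    have hAm : A ≤ m.domain := hD.ge
    obtain ⟨f1, hf1⟩ := hI.out (Submodule.inclusion hAB) (Submodule.inclusion_injective hAB)
      (m.toFun ∘ₗ Submodule.inclusion hAm)
    let w : B →ₗ[R] J := h ∘ₗ Submodule.inclusion hBt - g ∘ₗ f1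
    have hw : A.submoduleOf B ≤ LinearMap.ker w := by
      intro b hb
      have hb : (b : K) ∈ A := hb
      have h1 : f1 b = m ⟨b, hAm hb⟩ := hf1 ⟨b, hb⟩
      have h2 := hmS.2 b (hAm hb) (hBt b.2)
      rw [LinearMap.mem_ker]
      simp only [w, LinearMap.sub_apply, LinearMap.comp_apply, h1, h2]
      exact sub_self _
    obtain ⟨k, hk⟩ := hstep a ((A.submoduleOf B).liftQ w hw)
    let F : B →ₗ[R] I := f1 + k ∘ₗ (A.submoduleOf B).mkQ
    have hFm : (⟨B, F⟩ : K →ₗ.[R] I) ∈ 𝒮 := by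
      refine ⟨⟨_, rfl⟩, fun x hx hx' => ?_⟩
      have h3 := LinearMap.congr_fun hk ((A.submoduleOf B).mkQ ⟨x, hx⟩)
      change g (F ⟨x, hx⟩) = _
      simp only [F, LinearMap.add_apply, LinearMap.comp_apply, map_add] at h3 ⊢
      rw [h3]
      simp only [Submodule.mkQ_apply, Submodule.liftQ_apply, w, LinearMap.sub_apply,
        LinearMap.comp_apply]
      rw [add_sub_cancel]
      rfl
    have hle : m ≤ (⟨B, F⟩ : K →ₗ.[R] I) := by
      refine ⟨by rw [hD]; exact hAB, ?_⟩
      rintro ⟨x, hx⟩ ⟨y, hy⟩ hxy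
      obtain rfl : x = y := hxy
      have hxA : x ∈ A := by rw [← hD]; exact hx
      have h1 : f1 ⟨x, hy⟩ = m ⟨x, hx⟩ := hf1 ⟨x, hxA⟩
      have h2 : (A.submoduleOf B).mkQ ⟨x, hy⟩ = 0 := by
        rw [Submodule.mkQ_apply, Submodule.Quotient.mk_eq_zero]; exact hxA
      change m ⟨x, hx⟩ = F ⟨x, hy⟩
      simp only [F, LinearMap.add_apply, LinearMap.comp_apply, h1, h2, map_zero, add_zero]
    have hge := hm.le_of_ge hFm hle
    have hBD : LowerSet.Iic a ≤ D := le_sSup (show B ≤ m.domain from hge.1)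
    exact ha (hBD (LowerSet.mem_Iic_iff.2 le_rfl))

end Eklof

section Jensen

universe u

variable {R : Type u} [CommRing R]

/-- A kernel of a surjection from a free module onto a flat module is pure. -/
lemma ffd_pure (F : Type u) [AddCommGroup F] [Module R F] [Module.Flat R F]
    (g : (F →₀ R) →ₗ[R] F) (hgs : Function.Surjective g) (S : Finset (LinearMap.ker g)) :
    ∃ U : Finset (LinearMap.ker g), (S = ∅ → U = ∅) ∧
      ∃ φ : (F →₀ R) →ₗ[R] (LinearMap.ker g),
      (∀ s ∈ S, φ (s : F →₀ R) = s) ∧ ∀ p, φ p ∈ Submodule.span R (U : Set _) := by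
  classical
  rcases S.eq_empty_or_nonempty with rfl | hne
  · exact ⟨∅, fun _ => rfl, 0, by simp, by simp⟩
  let T : Finset F := S.biUnion fun s => s.1.support
  let j : (T →₀ R) →ₗ[R] (F →₀ R) := Finsupp.lmapDomain R R Subtype.val
  let π : (F →₀ R) →ₗ[R] (T →₀ R) := Finsupp.lsubtypeDomain (T : Set F)
  have hjπ : ∀ s ∈ S, j (π (s : F →₀ R)) = s := by
    intro s hs
    ext x
    by_cases hx : x ∈ T
    · have := Finsupp.mapDomain_apply (f := (Subtype.val : T → F)) Subtype.val_injective
        (π (s : F →₀ R)) ⟨x, hx⟩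
      simp only [j, Finsupp.lmapDomain_apply]
      rw [this]
      rfl
    · have h1 : (s : F →₀ R) x = 0 := by
        by_contra h0
        exact hx (Finset.mem_biUnion.2 ⟨s, hs, Finsupp.mem_support_iff.2 h0⟩)
      rw [h1]
      simp only [j, Finsupp.lmapDomain_apply]
      exact Finsupp.mapDomain_of_notMem_range _ _ (by simpa using hx)
  let f : (S →₀ R) →ₗ[R] (T →₀ R) :=
    Finsupp.linearCombination R fun s : S => π ((s : LinearMap.ker g) : F →₀ R)
  have hxf : (g ∘ₗ j) ∘ₗ f = 0 := by
    ext s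
    simp only [f, LinearMap.comp_apply, Finsupp.lsingle_apply, Finsupp.linearCombination_single,
      one_smul, LinearMap.zero_apply]
    rw [hjπ s.1 s.2]
    exact s.1.2
  obtain ⟨k, a, y, hya, haf⟩ := Module.Flat.exists_factorization_of_comp_eq_zero_of_free hxf
  obtain ⟨y', hy'⟩ := Module.projective_lifting_property g y hgs
  let φ0 : (T →₀ R) →ₗ[R] (LinearMap.ker g) := (j - y' ∘ₗ a).codRestrict _ (by
    intro x
    have h1 := LinearMap.congr_fun hya x
    have h2 := LinearMap.congr_fun hy' (a x)
    simp only [LinearMap.comp_apply] at h1 h2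
    simp [h1, h2])
  have hfg : (LinearMap.range φ0).FG := Module.Finite.iff_fg.1 inferInstance
  obtain ⟨U, hU⟩ := hfg
  refine ⟨U, fun h => absurd h hne.ne_empty, φ0 ∘ₗ π, ?_, ?_⟩
  · intro s hs
    have h1 : a (π (s : F →₀ R)) = 0 := by
      have := LinearMap.congr_fun haf (Finsupp.single ⟨s, hs⟩ 1)
      simpa [f] using this
    ext1
    change j (π (s : F →₀ R)) - y' (a (π (s : F →₀ R))) = _
    rw [h1, hjπ s hs, map_zero, sub_zero]
  · intro p
    rw [hU]
    exact ⟨π p, rfl⟩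

variable {K P : Type u} [AddCommGroup K] [Module R K] [AddCommGroup P] [Module R P]
  (ι : K →ₗ[R] P) (G : Finset K → Finset K)

lemma ffd_countable [Module.Projective R P]
    (hG : ∀ S : Finset K, ∃ φ : P →ₗ[R] K, (∀ s ∈ S, φ (ι s) = s) ∧
      ∀ p, φ p ∈ Submodule.span R (G S : Set K))
    (Y : Set K) (hY : FfdClosed G Y) (hc : Y.Countable) :
    Module.Projective R (Submodule.span R Y) := by
  classical
  rcases Y.eq_empty_or_nonempty with rfl | hne
  · have : Subsingleton (Submodule.span R (∅ : Set K)) := by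
      rw [Submodule.span_empty]; infer_instance
    infer_instance
  obtain ⟨e, he⟩ := hc.exists_eq_range hne
  choose φ hφ1 hφ2 using hG
  obtain ⟨S, hS0, hS⟩ : ∃ S : ℕ → Finset K, S 0 = ∅ ∧
      ∀ i, S (i + 1) = insert (e i) (S i ∪ G (S i)) :=
    ⟨fun i => Nat.rec ∅ (fun i S => insert (e i) (S ∪ G S)) i, rfl, fun i => rfl⟩
  have hSY : ∀ i, (S i : Set K) ⊆ Y := by
    intro i
    induction i with
    | zero => simp [hS0]
    | succ i ih =>
      rw [hS]
      intro x hx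
      simp only [Finset.coe_insert, Finset.coe_union, Set.mem_insert_iff, Set.mem_union] at hx
      rcases hx with rfl | hx | hx
      · rw [he]; exact ⟨i, rfl⟩
      · exact ih hx
      · exact hY _ ih hx
  have hSmono : Monotone S := monotone_nat_of_le_succ fun i => by
    rw [hS]; exact Finset.subset_union_left.trans (Finset.subset_insert _ _)
  let V : ℕ → Submodule R K := fun i => Submodule.span R (S i : Set K)
  have hVmono : Monotone V := fun i j h => Submodule.span_mono (Finset.coe_subset.2 (hSmono h))
  have hVex : ∀ x ∈ Submodule.span R Y, ∃ i, x ∈ V i := by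
    have : Submodule.span R Y ≤ ⨆ i, V i := by
      rw [Submodule.span_le, he]
      rintro _ ⟨i, rfl⟩
      refine Submodule.mem_iSup_of_mem (i + 1) (Submodule.subset_span ?_)
      rw [hS]; simp
    intro x hx
    exact (Submodule.mem_iSup_of_directed V hVmono.directed_le).1 (this hx)
  have hVY : ∀ i, V i ≤ Submodule.span R Y := fun i => Submodule.span_mono (hSY i)
  let ψ : ℕ → K →ₗ[R] K := fun i => LinearMap.id - φ (S i) ∘ₗ ι
  have hφV : ∀ i p, φ (S i) p ∈ V (i + 1) := fun i p => by
    refine Submodule.span_mono ?_ (hφ2 (S i) p)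
    rw [hS]
    exact Finset.coe_subset.2 (Finset.subset_union_right.trans (Finset.subset_insert _ _))
  have hψ0 : ∀ i, ∀ x ∈ V i, ψ i x = 0 := by
    intro i x hx
    have : V i ≤ LinearMap.ker (ψ i) := by
      rw [Submodule.span_le]
      intro s hs
      simp [ψ, hφ1 (S i) s hs]
    exact this hx
  let θ : ℕ → K →ₗ[R] K := fun i => Nat.rec LinearMap.id (fun i t => ψ i ∘ₗ t) i
  have hθ0 : ∀ x, θ 0 x = x := fun x => rfl
  have hθ : ∀ i x, θ (i + 1) x = θ i x - φ (S i) (ι (θ i x)) := fun i x => rfl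
  have hθV : ∀ j, ∀ x ∈ V j, ∀ i, θ i x ∈ V (max i j) := by
    intro j x hx i
    induction i with
    | zero => exact hVmono (le_max_right _ _) hx
    | succ i ih =>
      rw [hθ]
      refine sub_mem (hVmono ?_ ih) (hVmono (le_max_left _ _) (hφV i _))
      exact max_le_max (Nat.le_succ i) le_rfl
  have hθz : ∀ j, ∀ x ∈ V j, ∀ i, j < i → θ i x = 0 := by
    intro j x hx i hi
    obtain ⟨i, rfl⟩ : ∃ i', i = i' + 1 := ⟨i - 1, by omega⟩
    have h1 := hθV j x hx i
    rw [max_eq_left (by omega)] at h1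
    exact hψ0 i _ h1
  have hfin : ∀ x : Submodule.span R Y, (Function.support fun i => ι (θ i x)).Finite := by
    intro x
    obtain ⟨j, hj⟩ := hVex x x.2
    refine (Set.finite_Iic j).subset fun i hi => ?_
    by_contra hcon
    apply hi
    simp [hθz j x hj i (by simpa using hcon)]
  let s : Submodule.span R Y →ₗ[R] (ℕ →₀ P) :=
    { toFun := fun x => Finsupp.ofSupportFinite (fun i => ι (θ i x)) (hfin x)
      map_add' := fun x y => by ext i; simp [Finsupp.ofSupportFinite_coe]
      map_smul' := fun r x => by ext i; simp [Finsupp.ofSupportFinite_coe] }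
  let a : (ℕ →₀ P) →ₗ[R] Submodule.span R Y :=
    Finsupp.lsum R fun i => (φ (S i)).codRestrict _ fun p => hVY _ (hφV i p)
  have hproj : Module.Projective R (ℕ →₀ P) :=
    Module.Projective.of_equiv (finsuppLEquivDirectSum R P ℕ).symm
  refine Module.Projective.of_split s a ?_
  ext x
  obtain ⟨j, hj⟩ := hVex x x.2
  have hsx : ∀ i, s x i = ι (θ i x) := fun i => rfl
  have hsupp : (s x).support ⊆ Finset.range (j + 1) := by
    intro i hi
    rw [Finsupp.mem_support_iff, hsx] at hi
    rw [Finset.mem_range]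
    by_contra hcon
    exact hi (by rw [hθz j x hj i (by omega), map_zero])
  have h1 : ((a (s x) : Submodule.span R Y) : K) =
      ∑ i ∈ Finset.range (j + 1), φ (S i) (ι (θ i x)) := by
    simp only [a, Finsupp.lsum_apply]
    rw [Finsupp.sum_of_support_subset _ hsupp _ (by simp)]
    simp [hsx]
  have h2 : ∀ i, φ (S i) (ι (θ i x)) = θ i x - θ (i + 1) x := fun i => by
    rw [hθ]; abel
  simp only [LinearMap.comp_apply, LinearMap.id_apply]
  rw [h1, Finset.sum_congr rfl fun i _ => h2 i, Finset.sum_range_sub', hθ0,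
    hθz j x hj (j + 1) (by omega), sub_zero]

lemma ffd_quot_pd (hι : Function.Injective ι) [Module.Projective R P] (L : Submodule R K) (m : ℕ)
    (h : HasProjectiveDimensionLE (ModuleCat.of R L) m) :
    HasProjectiveDimensionLE (ModuleCat.of R (P ⧸ L.map ι)) (m + 1) := by
  have hS := ffd_shortExact (A := L) (B := P) (C := P ⧸ L.map ι) (ι ∘ₗ L.subtype) (L.map ι).mkQ
    (hι.comp L.injective_subtype) (Submodule.mkQ_surjective _) (by
      rw [LinearMap.exact_iff, Submodule.ker_mkQ, LinearMap.range_comp, Submodule.range_subtype])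
  have : Projective (ModuleCat.of R P) :=
      (IsProjective.iff_projective (R := R) (P := P)).1 inferInstance
  exact hS.hasProjectiveDimensionLT_X₃ (m + 1) h
    (inferInstanceAs (HasProjectiveDimensionLT (ModuleCat.of R P) (m + 1 + 1)))

lemma ffd_sub_pd (hι : Function.Injective ι) (A B : Submodule R K) (hAB : A ≤ B) (m : ℕ)
    (h1 : HasProjectiveDimensionLE (ModuleCat.of R (P ⧸ A.map ι)) m)
    (h2 : HasProjectiveDimensionLE (ModuleCat.of R (P ⧸ B.map ι)) m) :
    HasProjectiveDimensionLE (ModuleCat.of R (B ⧸ A.submoduleOf B)) m := by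
  have hle : A.submoduleOf B ≤ (A.map ι).comap (ι ∘ₗ B.subtype) := by
    intro b hb
    exact ⟨b, hb, rfl⟩
  have hS := ffd_shortExact (A := B ⧸ A.submoduleOf B) (B := P ⧸ A.map ι) (C := P ⧸ B.map ι)
    (Submodule.mapQ _ _ (ι ∘ₗ B.subtype) hle) (Submodule.factor (Submodule.map_mono hAB))
    (by
      rw [injective_iff_map_eq_zero]
      intro x
      obtain ⟨b, rfl⟩ := Submodule.mkQ_surjective _ x
      intro hb
      simp only [Submodule.mkQ_apply, Submodule.mapQ_apply, Submodule.Quotient.mk_eq_zero] at hb ⊢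
      obtain ⟨a, ha, hab⟩ := hb
      have : a = b := hι hab
      change (b : K) ∈ A
      rw [← this]; exact ha)
    (Submodule.factor_surjective _)
    (by
      intro x
      obtain ⟨p, rfl⟩ := Submodule.mkQ_surjective _ x
      constructor
      · intro hp
        have hp : (Submodule.Quotient.mk p : P ⧸ B.map ι) = 0 := hp
        rw [Submodule.Quotient.mk_eq_zero] at hp
        obtain ⟨b, hb, rfl⟩ := hp
        exact ⟨Submodule.Quotient.mk ⟨b, hb⟩, rfl⟩
      · rintro ⟨y, hy⟩
        obtain ⟨b, rfl⟩ := Submodule.mkQ_surjective _ y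
        rw [← hy]
        change (Submodule.Quotient.mk (ι b) : P ⧸ B.map ι) = 0
        rw [Submodule.Quotient.mk_eq_zero]
        exact ⟨b, b.2, rfl⟩)
  exact hS.hasProjectiveDimensionLT_X₁ (m + 1) h1
    (hasProjectiveDimensionLT_of_ge _ (m + 1) (m + 1 + 1) (by omega))

open Cardinal in
lemma ffd_main (n : ℕ)
    (hF : ∀ (M : ModuleCat.{u} R) (m : ℕ), HasProjectiveDimensionLE M m →
      HasProjectiveDimensionLE M n)
    (hι : Function.Injective ι) [Module.Projective R P] (hG0 : G ∅ = ∅)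
    (hG : ∀ S : Finset K, ∃ φ : P →ₗ[R] K, (∀ s ∈ S, φ (ι s) = s) ∧
      ∀ p, φ p ∈ Submodule.span R (G S : Set K)) (κ : Cardinal.{u}) :
    ∀ Y : Set K, FfdClosed G Y → #Y = κ →
      HasProjectiveDimensionLE (ModuleCat.of R (P ⧸ (Submodule.span R Y).map ι)) n := by
  induction κ using WellFoundedLT.induction with
  | ind κ ih =>
    intro Y hY hκ
    rcases le_or_gt κ ℵ₀ with hle | hlt
    · have hc : Y.Countable := by rw [← Cardinal.le_aleph0_iff_set_countable, hκ]; exact hle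
      have := ffd_countable ι G hG Y hY hc
      have : Projective (ModuleCat.of R (Submodule.span R Y)) :=
        (IsProjective.iff_projective (R := R) (P := Submodule.span R Y)).1 inferInstance
      exact hF _ 1 (ffd_quot_pd ι hι _ 0 ((projective_iff_hasProjectiveDimensionLE_zero _).1 this))
    · obtain ⟨e⟩ : Nonempty (κ.ord.ToType ≃ Y) := by
        rw [← Cardinal.eq, hκ]; simp
      let L : LowerSet κ.ord.ToType → Submodule R K := fun D =>
        Submodule.span R (ffdCl G ((fun t => (e t : K)) '' (D : Set κ.ord.ToType)))
      have hsmall : ∀ D : LowerSet κ.ord.ToType, #(D : Set κ.ord.ToType) < κ →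
          HasProjectiveDimensionLE (ModuleCat.of R (P ⧸ (L D).map ι)) n := by
        intro D hD
        refine ih _ ?_ _ (ffdCl_closed G _) rfl
        refine (ffdCl_card G _).trans_lt (max_lt hlt (Cardinal.mk_image_le.trans_lt hD))
      have hIio : ∀ a : κ.ord.ToType, #(Set.Iio a) < κ := fun a => by
        simpa using Cardinal.mk_Iio_lt a
      have hIic : ∀ a : κ.ord.ToType, #(Set.Iic a) < κ := fun a => by
        rw [← Set.Iio_insert]
        refine Cardinal.mk_insert_le.trans_lt ?_
        exact Cardinal.add_lt_of_lt hlt.le (hIio a) (Cardinal.one_lt_aleph0.trans hlt)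
      have hLmono : Monotone L := fun D E h =>
        Submodule.span_mono (ffdCl_mono G (Set.image_mono h))
      have hLtop : L ⊤ = Submodule.span R Y := by
        have : ((fun t => (e t : K)) '' ((⊤ : LowerSet κ.ord.ToType) : Set κ.ord.ToType)) = Y := by
          ext x
          simp only [LowerSet.coe_top, Set.image_univ, Set.mem_range]
          exact ⟨fun ⟨t, ht⟩ => ht ▸ (e t).2, fun hx => ⟨e.symm ⟨x, hx⟩, by simp⟩⟩
        simp only [L, this]
        exact le_antisymm (Submodule.span_mono (ffdCl_subset subset_rfl hY))
          (Submodule.span_mono (subset_ffdCl G Y))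
      have hpd : HasProjectiveDimensionLE (ModuleCat.of R (L ⊤)) n := by
        apply hasProjectiveDimensionLT_of_enoughInjectives
        intro N
        obtain ⟨I, J, g, hI, hlift⟩ := ffd_exists_lift n N
        rw [hlift]
        refine ffd_eklof g.hom (Module.injective_module_of_injective_object R I) L hLmono ?_ ?_
        · intro c
          refine Submodule.span_le.2 ((ffdCl_sUnion G hG0 _ c).trans ?_)
          refine Set.iUnion₂_subset fun D hD => ?_
          exact Submodule.subset_span.trans (le_iSup₂_of_le (f := fun D (_ : D ∈ c) => L D) D hD le_rfl)
        · intro a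
          have h1 := ffd_sub_pd ι hι (L (LowerSet.Iio a)) (L (LowerSet.Iic a))
            (hLmono (show LowerSet.Iio a ≤ LowerSet.Iic a from fun x hx =>
              LowerSet.mem_Iic_iff.2 (le_of_lt (LowerSet.mem_Iio_iff.1 hx)))) n (hsmall _ (hIio a)) (hsmall _ (hIic a))
          rw [← hlift (ModuleCat.of R
            (L (LowerSet.Iic a) ⧸ (L (LowerSet.Iio a)).submoduleOf (L (LowerSet.Iic a))))]
          exact HasProjectiveDimensionLT.subsingleton _ (n + 1) (n + 1) le_rfl N
      rw [hLtop] at hpd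
      exact hF _ (n + 1) (ffd_quot_pd ι hι _ n hpd)

/-- Jensen's theorem. -/
lemma ffd_jensen (n : ℕ)
    (hF : ∀ (M : ModuleCat.{u} R) (m : ℕ), HasProjectiveDimensionLE M m →
      HasProjectiveDimensionLE M n) (F : ModuleCat.{u} R) (hflat : Module.Flat R F) :
    HasProjectiveDimensionLE F n := by
  let g : (F →₀ R) →ₗ[R] F := Finsupp.linearCombination R id
  choose G hG0 hG using ffd_pure (R := R) F g (Finsupp.linearCombination_id_surjective R F)
  have h := ffd_main (LinearMap.ker g).subtype G n hF (Submodule.injective_subtype _)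
    (hG0 ∅ rfl) hG _ Set.univ (fun _ _ => Set.subset_univ _) rfl
  rw [Submodule.span_univ, Submodule.map_top, Submodule.range_subtype] at h
  exact ModuleCat.hasProjectiveDimensionLE_of_linearEquiv
    (M := ModuleCat.of R ((F →₀ R) ⧸ LinearMap.ker g)) (N := F)
    (g.quotKerEquivOfSurjective (Finsupp.linearCombination_id_surjective R F)) n

end Jensen

/-- For any commutative ring `R`, `FFD R ≤ FPD R`. -/
theorem stmt_3 (R : Type u) [CommRing R] :
    FFD R ≤ FPD R := by
  rcases eq_or_ne (FPD R) ⊤ with htop | hne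
  · rw [htop]; exact le_top
  obtain ⟨n, hn⟩ := ENat.ne_top_iff_exists.1 hne
  have hF : ∀ (M : ModuleCat.{u} R) (m : ℕ), HasProjectiveDimensionLE M m →
      HasProjectiveDimensionLE M n := by
    intro M m h
    have h1 : pd R M ≤ m := sInf_le ⟨m, (ffd_pdLE_iff M m).2 h, rfl⟩
    have h2 : pd R M ≠ ⊤ := ne_top_of_le_ne_top (ENat.natCast_ne_top m) h1
    have h3 : pd R M ≤ n := by
      rw [hn]; exact le_sSup ⟨h2, M, rfl⟩
    have hmem : pd R M ∈ ((↑) '' {n : ℕ | pdLE R M n} : Set ℕ∞) :=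
      csInf_mem ⟨_, m, (ffd_pdLE_iff M m).2 h, rfl⟩
    obtain ⟨k, hk, hke⟩ := hmem
    rw [← hke] at h3
    have hkn : k ≤ n := by exact_mod_cast h3
    have := (ffd_pdLE_iff M k).1 hk
    exact hasProjectiveDimensionLT_of_ge M (k + 1) (n + 1) (by omega)
  rw [← hn]
  apply sSup_le
  rintro d ⟨hd, M, rfl⟩
  have hex : ∃ m, fdLE R M m := by
    by_contra hcon
    push Not at hcon
    apply hd
    have : {n : ℕ | fdLE R M n} = ∅ := Set.eq_empty_of_forall_notMem hcon
    simp [fd, this]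
  obtain ⟨m, hm⟩ := hex
  have h1 := hF M _ (ffd_pd_of_fd n (ffd_jensen n hF) m M hm)
  exact sInf_le ⟨n, ffd_fd_of_pd n M h1, rfl⟩
end

section
/- Let R be a commutative ring with finite weak dimension. Then FID(R) ≤ FCD(R) + wdim(R). -/
open CategoryTheory Opposite

section helpers
open CategoryTheory Opposite Limits
open scoped TensorProduct

theorem flat_aux {R : Type u} [CommRing R] {Q2 Q1 Q0 Z : Type u}
    [AddCommGroup Q2] [Module R Q2] [AddCommGroup Q1] [Module R Q1]
    [AddCommGroup Q0] [Module R Q0] [AddCommGroup Z] [Module R Z]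
    (a : Q2 →ₗ[R] Q1) (b : Q1 →ₗ[R] Q0) (p : Q0 →ₗ[R] Z)
    (hp : Function.Surjective p) (hbp : Function.Exact b p) [Module.Flat R Q0]
    (hba : b ∘ₗ a = 0)
    (H : ∀ (X : Type u) [AddCommGroup X] [Module R X],
      ∀ q : X ⊗[R] Q1, b.lTensor X q = 0 → ∃ s, a.lTensor X s = q) :
    Module.Flat R Z := by
  rw [Module.Flat.iff_rTensor_preserves_injective_linearMap]
  intro A A' _ _ _ _ f hf
  rw [← LinearMap.ker_eq_bot, LinearMap.ker_eq_bot']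
  intro z hz
  obtain ⟨x, rfl⟩ := LinearMap.lTensor_surjective A hp z
  have comm : ∀ {U V S T : Type u} [AddCommGroup U] [Module R U] [AddCommGroup V] [Module R V]
      [AddCommGroup S] [Module R S] [AddCommGroup T] [Module R T] (g : U →ₗ[R] V)
      (h : S →ₗ[R] T) (x : U ⊗[R] S),
      g.rTensor T (h.lTensor U x) = h.lTensor V (g.rTensor S x) := by
    intro U V S T _ _ _ _ _ _ _ _ g h x
    rw [← LinearMap.comp_apply, ← LinearMap.comp_apply, LinearMap.rTensor_comp_lTensor,
      LinearMap.lTensor_comp_rTensor]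
  rw [comm] at hz
  obtain ⟨q', hq'⟩ := (lTensor_exact A' hbp hp _).1 hz
  let π := (LinearMap.range f).mkQ
  have hπ : Function.Surjective π := Submodule.mkQ_surjective _
  have hfπ : Function.Exact f π := LinearMap.exact_map_mkQ_range f
  have h1 : b.lTensor _ (π.rTensor Q1 q') = 0 := by
    rw [← comm, hq']
    exact (rTensor_exact Q0 hfπ hπ).apply_apply_eq_zero x
  obtain ⟨s, hs⟩ := H _ _ h1
  obtain ⟨s', rfl⟩ := LinearMap.rTensor_surjective Q2 hπ s
  rw [← comm] at hs
  have h2 : π.rTensor Q1 (q' - a.lTensor A' s') = 0 := by rw [map_sub, hs, sub_self]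
  obtain ⟨q, hq⟩ := (rTensor_exact Q1 hfπ hπ _).1 h2
  have h3 : b.lTensor A' (a.lTensor A' s') = 0 := by
    rw [← LinearMap.comp_apply, ← LinearMap.lTensor_comp, hba]; simp
  have h4 : x = b.lTensor A q := by
    apply Module.Flat.rTensor_preserves_injective_linearMap (M := Q0) f hf
    rw [comm, hq, map_sub, h3, sub_zero, hq']
  rw [h4]
  exact (lTensor_exact A hbp hp).apply_apply_eq_zero q

/-- The shifted complex. -/
noncomputable def shiftC {C : Type*} [Category C] [Abelian C] (K : ChainComplex C ℕ) (w : ℕ) :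
    ChainComplex C ℕ where
  X i := K.X (i + w)
  d i j := K.d (i + w) (j + w)
  shape i j h := K.shape _ _ (by simp at h ⊢; omega)
  d_comp_d' i j k _ _ := K.d_comp_d _ _ _

/-- The shifted resolution of a syzygy. -/
noncomputable def shiftRes {C : Type*} [Category C] [Abelian C] {N : C}
    (P : ProjectiveResolution N) (w : ℕ) :
    ProjectiveResolution (cokernel ((shiftC P.complex w).d 1 0)) where
  complex := shiftC P.complex w
  projective n := P.projective (n + w)
  π := (ChainComplex.toSingle₀Equiv _ _).symm ⟨cokernel.π _, cokernel.condition _⟩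
  quasiIso := ⟨fun n => by
    cases n with
    | zero =>
      rw [ChainComplex.quasiIsoAt₀_iff, ShortComplex.quasiIso_iff_of_zeros']
      · refine (ShortComplex.exact_and_epi_g_iff_of_iso ?_).2
          ⟨ShortComplex.exact_cokernel ((shiftC P.complex w).d 1 0), by infer_instance⟩
        exact ShortComplex.isoMk (Iso.refl _) (Iso.refl _) (Iso.refl _)
          (by simp; exact (Category.id_comp _).trans (Category.comp_id _).symm)
          (by simp; exact (Category.id_comp _).trans (Category.comp_id _).symm)
      · exact (shiftC P.complex w).shape 0 0 (by simp)
      · rfl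
      · rfl
    | succ n =>
      rw [quasiIsoAt_iff_exactAt']
      · rw [HomologicalComplex.exactAt_iff' _ (n + 2) (n + 1) n (by simp) (by simp)]
        have := P.complex_exactAt_succ (n + w)
        have e : n + w + 1 = n + 1 + w := by omega
        rw [e] at this
        rw [HomologicalComplex.exactAt_iff' _ (n + 2 + w) (n + 1 + w) (n + w)
          (ComplexShape.prev_eq' _ (by simp; omega)) (ComplexShape.next_eq' _ (by simp; omega))] at this
        exact this
      · apply ChainComplex.exactAt_succ_single_obj⟩

theorem extVanish_iff {R : Type u} [CommRing R] {N : ModuleCat.{u} R}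
    (P : ProjectiveResolution N) (M : ModuleCat.{u} R) (i j k : ℕ) (hi : j = i + 1)
    (hk : k = j + 1) :
    ExtVanish R N M j ↔ ∀ f : P.complex.X j ⟶ M, P.complex.d k j ≫ f = 0 →
      ∃ g : P.complex.X i ⟶ M, P.complex.d j i ≫ g = f := by
  unfold ExtVanish
  rw [← ModuleCat.isZero_iff_subsingleton, Iso.isZero_iff (P.isoExt j M),
    ← HomologicalComplex.exactAt_iff_isZero_homology,
    HomologicalComplex.exactAt_iff' _ i j k (ComplexShape.prev_eq' _ (by simp; omega)) (ComplexShape.next_eq' _ (by simp; omega)),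
    ShortComplex.moduleCat_exact_iff]
  rfl

theorem torVanish_iff {R : Type u} [CommRing R] {N : ModuleCat.{u} R}
    (P : ProjectiveResolution N) (M : ModuleCat.{u} R) (i j k : ℕ) (hi : j = i + 1)
    (hk : k = j + 1) :
    TorVanish R M N j ↔ ∀ q : M ⊗[R] P.complex.X j, (P.complex.d j i).hom.lTensor M q = 0 →
      ∃ s, (P.complex.d k j).hom.lTensor M s = q := by
  unfold TorVanish
  rw [← ModuleCat.isZero_iff_subsingleton]
  dsimp only [Tor]
  rw [Iso.isZero_iff (P.isoLeftDerivedObj _ j)]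
  dsimp only [HomologicalComplex.homologyFunctor]
  rw [← HomologicalComplex.exactAt_iff_isZero_homology,
    HomologicalComplex.exactAt_iff' _ k j i (ComplexShape.prev_eq' _ (by simp; omega)) (ComplexShape.next_eq' _ (by simp; omega)),
    ShortComplex.moduleCat_exact_iff]
  rfl

theorem fdLE_succ {R : Type u} [CommRing R] {M : ModuleCat.{u} R} {n : ℕ} (h : fdLE R M n) :
    fdLE R M (n + 1) := by
  intro N
  let P := ProjectiveResolution.of N
  have := h (cokernel ((shiftC P.complex 1).d 1 0))
  rw [torVanish_iff (shiftRes P 1) M n (n + 1) (n + 2) rfl rfl] at this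
  rw [torVanish_iff P M (n + 1) (n + 2) (n + 3) rfl rfl]
  exact this

theorem fdLE_mono {R : Type u} [CommRing R] {M : ModuleCat.{u} R} {n m : ℕ} (h : fdLE R M n)
    (hnm : n ≤ m) : fdLE R M m := by
  induction m, hnm using Nat.le_induction with
  | base => exact h
  | succ m _ ih => exact fdLE_succ ih

theorem flat_syzygy {R : Type u} [CommRing R] {N : ModuleCat.{u} R}
    (P : ProjectiveResolution N) (w : ℕ) (h : ∀ X : ModuleCat.{u} R, fdLE R X w) :
    Module.Flat R ((cokernel ((shiftC P.complex w).d 1 0) : ModuleCat.{u} R)) := by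
  have hproj : Module.Projective R ((shiftC P.complex w).X 0) :=
    (IsProjective.iff_projective _).2 ((shiftRes P w).projective 0)
  refine flat_aux ((shiftC P.complex w).d 2 1).hom ((shiftC P.complex w).d 1 0).hom
    (cokernel.π ((shiftC P.complex w).d 1 0)).hom ?_ ?_ ?_ ?_
  · exact (ModuleCat.epi_iff_surjective _).1 inferInstance
  · exact (ShortComplex.ShortExact.moduleCat_exact_iff_function_exact _).1
      (ShortComplex.exact_cokernel ((shiftC P.complex w).d 1 0))
  · rw [← ModuleCat.hom_comp, HomologicalComplex.d_comp_d]; rfl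
  · intro X _ _
    have := h (ModuleCat.of R X) N
    have e2 : w + 1 = 1 + w := by omega
    rw [e2, torVanish_iff P _ (0 + w) (1 + w) (2 + w) (by omega) (by omega)] at this
    exact this

end helpers

/-- If `R` has finite weak dimension, then `FID R ≤ FCD R + wdim R`. -/
theorem stmt_9 (R : Type u) [CommRing R] (h : wdim R < ⊤) :
    FID R ≤ FCD R + wdim R := by
  obtain ⟨w, hw⟩ := ENat.ne_top_iff_exists.1 h.ne
  have attain : ∀ S : Set ℕ, sInf ((↑) '' S : Set ℕ∞) ≠ ⊤ →
      ∃ n ∈ S, sInf ((↑) '' S : Set ℕ∞) = n := by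
    intro S hS
    have hne : ((↑) '' S : Set ℕ∞).Nonempty := by
      by_contra hc
      rw [Set.not_nonempty_iff_eq_empty] at hc
      rw [hc] at hS
      simp at hS
    obtain ⟨n, hn, e⟩ := csInf_mem hne
    exact ⟨n, hn, e.symm⟩
  have hfd : ∀ X : ModuleCat.{u} R, fdLE R X w := by
    intro X
    have h1 : fd R X ≤ w := hw ▸ le_iSup (fun M => fd R M) X
    obtain ⟨n, hn, e⟩ := attain {n | fdLE R X n} (ne_top_of_le_ne_top (ENat.natCast_ne_top w) h1)
    refine fdLE_mono hn ?_
    have h2 : (n : ℕ∞) ≤ w := e ▸ h1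
    exact_mod_cast h2
  refine sSup_le ?_
  rintro d ⟨hd, M, rfl⟩
  obtain ⟨m, hm, -⟩ := attain {n | idLE R M n} hd
  have hcd : cd R M ≤ m := sInf_le ⟨m, fun F _ => hm F, rfl⟩
  have hcd' : cd R M ≠ ⊤ := ne_top_of_le_ne_top (ENat.natCast_ne_top m) hcd
  obtain ⟨c, hc, ec⟩ := attain {n | cdLE R M n} hcd'
  have hcF : (c : ℕ∞) ≤ FCD R := by
    rw [← ec]
    exact le_sSup ⟨hcd', M, rfl⟩
  have hid : idLE R M (c + w) := by
    intro N
    let P := ProjectiveResolution.of N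
    have := hc _ (flat_syzygy P w hfd)
    rw [extVanish_iff (shiftRes P w) M c (c + 1) (c + 2) rfl rfl] at this
    have e2 : c + w + 1 = c + 1 + w := by omega
    rw [e2, extVanish_iff P M (c + w) (c + 1 + w) (c + 2 + w) (by omega) (by omega)]
    exact this
  calc injd R M ≤ ((c + w : ℕ) : ℕ∞) := sInf_le ⟨c + w, hid, rfl⟩
    _ = c + w := by push_cast; rfl
    _ ≤ FCD R + wdim R := by rw [← hw]; gcongr
end

section
/- Let R be an integral domain which is not a field, with quotient field Q. If cot.D(R) = FPD(R) < ∞, then cot.D(R) = pd_R(Q). -/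
open CategoryTheory Opposite

/-- `Ext` vanishing via cocycles of a projective resolution. -/
lemma extVanish_iff_s11 (R : Type u) [CommRing R] (M N : ModuleCat.{u} R) (n : ℕ) :
    ExtVanish R M N (n + 1) ↔ Subsingleton (Abelian.Ext.{u} M N (n + 1)) := by
  let P := projectiveResolution M
  have e := P.isoExt (R := R) (n + 1) N
  have h1 : ExtVanish R M N (n + 1) ↔
      ∀ f : P.complex.X (n + 1) ⟶ N, P.complex.d (n + 2) (n + 1) ≫ f = 0 →
        ∃ g : P.complex.X n ⟶ N, P.complex.d (n + 1) n ≫ g = f := by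
    unfold ExtVanish
    rw [← ModuleCat.isZero_iff_subsingleton, e.isZero_iff,
      ← HomologicalComplex.exactAt_iff_isZero_homology,
      HomologicalComplex.exactAt_iff' _ n (n + 1) (n + 2) (by simp) (by simp),
      ShortComplex.moduleCat_exact_iff]
    rfl
  rw [h1]
  constructor
  · intro h
    refine ⟨fun a b => ?_⟩
    have key : ∀ a : Abelian.Ext.{u} M N (n + 1), a = 0 := by
      intro a
      obtain ⟨f, hf, rfl⟩ := P.extMk_surjective a (n + 2) rfl
      rw [P.extMk_eq_zero_iff f (n + 2) rfl hf n rfl]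
      exact h f hf
    rw [key a, key b]
  · intro h f hf
    rw [← P.extMk_eq_zero_iff f (n + 2) rfl hf n rfl]
    exact Subsingleton.elim _ _

lemma pdLE_iff (R : Type u) [CommRing R] (M : ModuleCat.{u} R) (n : ℕ) :
    pdLE R M n ↔ HasProjectiveDimensionLT M (n + 1) := by
  unfold pdLE
  simp only [extVanish_iff_s11]
  constructor
  · intro h
    exact hasProjectiveDimensionLT_of_enoughInjectives M (n + 1) h
  · intro h N
    exact HasProjectiveDimensionLT.subsingleton M (n + 1) (n + 1) le_rfl N

lemma pd_le_iff (R : Type u) [CommRing R] (M : ModuleCat.{u} R) (n : ℕ) :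
    pd R M ≤ n ↔ HasProjectiveDimensionLT M (n + 1) := by
  constructor
  · intro h
    have hne : ((↑) '' {n : ℕ | pdLE R M n} : Set ℕ∞).Nonempty := by
      by_contra hc
      rw [Set.not_nonempty_iff_eq_empty] at hc
      unfold pd at h
      rw [hc, sInf_empty] at h
      exact absurd h (by simp)
    obtain ⟨m, hm, hm'⟩ := csInf_mem hne
    have hle : m ≤ n := by
      have : (m : ℕ∞) ≤ n := by rw [hm']; exact h
      exact_mod_cast this
    have := (pdLE_iff R M m).1 hm
    exact hasProjectiveDimensionLT_of_ge M (m + 1) (n + 1) (by lia)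
  · intro h
    exact sInf_le ⟨n, (pdLE_iff R M n).2 h, rfl⟩

lemma finsupp_shortExact (R : Type u) [CommRing R] (I : Type u) {A B C : Type u}
    [AddCommGroup A] [Module R A] [AddCommGroup B] [Module R B] [AddCommGroup C] [Module R C]
    (p : A →ₗ[R] B) (q : B →ₗ[R] C) (hpq : Function.Exact p q) (hp : Function.Injective p)
    (hq : Function.Surjective q) :
    ∃ w, (ShortComplex.mk (X₁ := ModuleCat.of R (I →₀ A)) (X₂ := ModuleCat.of R (I →₀ B))
      (X₃ := ModuleCat.of R (I →₀ C))
      (ModuleCat.ofHom (Finsupp.mapRange.linearMap p))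
      (ModuleCat.ofHom (Finsupp.mapRange.linearMap q)) w).ShortExact := by
  let g : (I →₀ A) →ₗ[R] (I →₀ B) := Finsupp.mapRange.linearMap p
  let k : (I →₀ B) →ₗ[R] (I →₀ C) := Finsupp.mapRange.linearMap q
  have hgk : Function.Exact g k := by
    intro x
    constructor
    · intro hx
      have hx' : ∀ i, ∃ a, p a = x i := fun i => by
        have := DFunLike.congr_fun hx i
        exact (hpq _).1 (by simpa [k] using this)
      choose y hy using hx'
      refine ⟨Finsupp.onFinset x.support y ?_, ?_⟩
      · intro i hi
        rw [Finsupp.mem_support_iff]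
        intro h0
        exact hi (hp (by rw [hy, h0, map_zero]))
      · ext1 i
        simp [g, hy]
    · rintro ⟨y, rfl⟩
      ext i
      simpa [g, k] using hpq.apply_apply_eq_zero (y i)
  have hg : Function.Injective g := Finsupp.mapRange_injective _ (map_zero _) hp
  have hk : Function.Surjective k := Finsupp.mapRange_surjective _ (map_zero _) hq
  refine ⟨?_, ?_⟩
  · ext1
    exact LinearMap.ext fun x => (hgk _).2 ⟨x, rfl⟩
  · exact
      { exact := (ShortComplex.ShortExact.moduleCat_exact_iff_function_exact _).2 hgk
        mono_f := (ModuleCat.mono_iff_injective _).2 hg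
        epi_g := (ModuleCat.epi_iff_surjective _).2 hk }

lemma exists_presentation (R : Type u) [CommRing R] (M : Type u) [AddCommGroup M] [Module R M] :
    ∃ (A B : ModuleCat.{u} R) (p : A →ₗ[R] B) (q : B →ₗ[R] M), Module.Projective R B ∧
      Function.Exact p q ∧ Function.Injective p ∧ Function.Surjective q :=
  let f : (M →₀ R) →ₗ[R] M := Finsupp.linearCombination R id
  ⟨ModuleCat.of R (LinearMap.ker f), ModuleCat.of R (M →₀ R), (LinearMap.ker f).subtype, f,
    inferInstanceAs (Module.Projective R (M →₀ R)), LinearMap.exact_subtype_ker_map f,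
    Submodule.injective_subtype _, Finsupp.linearCombination_id_surjective R M⟩

lemma hasPD_finsupp (R : Type u) [CommRing R] (I : Type u) (n : ℕ) :
    ∀ (M : Type u) [AddCommGroup M] [Module R M],
      HasProjectiveDimensionLT (ModuleCat.of R M) (n + 1) →
      HasProjectiveDimensionLT (ModuleCat.of R (I →₀ M)) (n + 1) := by
  induction n with
  | zero =>
    intro M _ _ h
    have hp : Projective (ModuleCat.of R M) := inferInstance
    have : Module.Projective R M := (IsProjective.iff_projective M).2 hp
    have : Module.Projective R (I →₀ M) := by
      classical
      exact Module.Projective.of_equiv (finsuppLEquivDirectSum R M I).symm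
    have : Projective (ModuleCat.of R (I →₀ M)) := (IsProjective.iff_projective _).1 this
    infer_instance
  | succ n ih =>
    intro M _ _ h
    obtain ⟨A, B, p, q, hB, hpq, hp, hq⟩ := exists_presentation R M
    let S : ShortComplex (ModuleCat.{u} R) :=
      ShortComplex.mk (X₁ := A) (X₂ := B) (X₃ := ModuleCat.of R M)
        (ModuleCat.ofHom p) (ModuleCat.ofHom q) (by
          ext1
          exact LinearMap.ext fun x => (hpq _).2 ⟨x, rfl⟩)
    have hS : S.ShortExact :=
      { exact := (ShortComplex.ShortExact.moduleCat_exact_iff_function_exact S).2 hpq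
        mono_f := (ModuleCat.mono_iff_injective _).2 hp
        epi_g := (ModuleCat.epi_iff_surjective _).2 hq }
    have hB1 : HasProjectiveDimensionLT (ModuleCat.of R B) (0 + 1) := by
      have : Projective (ModuleCat.of R B) := (IsProjective.iff_projective B).1 hB
      infer_instance
    have hA : HasProjectiveDimensionLT (ModuleCat.of R A) (n + 1) :=
      hS.hasProjectiveDimensionLT_X₁ (n + 1)
        (hasProjectiveDimensionLT_of_ge (ModuleCat.of R B) 1 (n + 1) (by lia)) h
    obtain ⟨w, hSS⟩ := finsupp_shortExact R I p q hpq hp hq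
    refine hSS.hasProjectiveDimensionLT_X₃ (n + 1) (ih A hA) ?_
    have hBI : Module.Projective R (I →₀ B) := by
      classical
      exact Module.Projective.of_equiv (finsuppLEquivDirectSum R B I).symm
    have : Projective (ModuleCat.of R (I →₀ B)) := (IsProjective.iff_projective _).1 hBI
    exact hasProjectiveDimensionLT_of_ge (ModuleCat.of R (I →₀ B)) 1 (n + 1 + 1) (by lia)

/-- Every flat module over a domain embeds into a direct sum of copies of `Q`. -/
lemma flat_embeds (R : Type u) [CommRing R] [IsDomain R] (F : Type u) [AddCommGroup F]
    [Module R F] [Module.Flat R F] :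
    ∃ (I : Type u) (f : F →ₗ[R] (I →₀ FractionRing R)), Function.Injective f := by
  let Q := FractionRing R
  let V := TensorProduct R Q F
  let b := Module.Free.chooseBasis Q V
  refine ⟨Module.Free.ChooseBasisIndex Q V,
    (b.repr.toLinearMap.restrictScalars R) ∘ₗ
      ((Algebra.linearMap R Q).rTensor F) ∘ₗ (TensorProduct.lid R F).symm.toLinearMap, ?_⟩
  have h1 : Function.Injective ((Algebra.linearMap R Q).rTensor F) :=
    Module.Flat.rTensor_preserves_injective_linearMap _ (IsFractionRing.injective R Q)
  exact b.repr.injective.comp (h1.comp (TensorProduct.lid R F).symm.injective)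

/-- For a domain `R` which is not a field, with quotient field `Q`:
if `cot.D R = FPD R < ∞` then `cot.D R = pd_R Q`. -/
theorem stmt_11 (R : Type u) [CommRing R] [IsDomain R] (hnf : ¬ IsField R)
    (h : cotD R = FPD R) (hfin : FPD R < ⊤) :
    cotD R = pd R (ModuleCat.of R (FractionRing R)) := by
  have hflatQ : pd R (ModuleCat.of R (FractionRing R)) ≤ cotD R :=
    le_iSup₂_of_le (f := fun (M : ModuleCat.{u} R) (_ : Module.Flat R M) => pd R M)
      (ModuleCat.of R (FractionRing R))
      (IsLocalization.flat (FractionRing R) (nonZeroDivisors R)) le_rfl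
  refine le_antisymm ?_ hflatQ
  obtain ⟨n, hn⟩ := ENat.ne_top_iff_exists.1 hfin.ne
  obtain ⟨m, hm⟩ := ENat.ne_top_iff_exists.1 (hflatQ.trans_lt (h ▸ hfin)).ne
  rw [← hm]
  have hQ := (pd_le_iff R _ m).1 hm.ge
  by_contra hlt
  rw [not_le, h, ← hn] at hlt
  have hmn : m < n := by exact_mod_cast hlt
  refine absurd (?_ : cotD R ≤ (n - 1 : ℕ)) ?_
  · refine iSup₂_le fun F hF => ?_
    rw [pd_le_iff, Nat.sub_add_cancel (by lia)]
    obtain ⟨I, f, hf⟩ := flat_embeds R F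
    have hQI := hasPD_finsupp R I m _ hQ
    let k := (LinearMap.range f).mkQ
    have hfk : Function.Exact f k := LinearMap.exact_map_mkQ_range f
    let S : ShortComplex (ModuleCat.{u} R) :=
      ShortComplex.mk (X₁ := ModuleCat.of R F) (ModuleCat.ofHom f) (ModuleCat.ofHom k) (by
        ext1
        exact LinearMap.ext fun x => (hfk _).2 ⟨x, rfl⟩)
    have hS : S.ShortExact :=
      { exact := (ShortComplex.ShortExact.moduleCat_exact_iff_function_exact S).2 hfk
        mono_f := (ModuleCat.mono_iff_injective _).2 hf
        epi_g := (ModuleCat.epi_iff_surjective _).2 (Submodule.mkQ_surjective _) }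
    have hX₂ : HasProjectiveDimensionLT S.X₂ n :=
      have : HasProjectiveDimensionLT S.X₂ (m + 1) := hQI
      hasProjectiveDimensionLT_of_ge _ (m + 1) n (by lia)
    have hX₁ : HasProjectiveDimensionLT S.X₁ (n + 1) := by
      refine (pd_le_iff R F n).1 ?_
      rw [hn, ← h]
      exact le_iSup₂_of_le (f := fun (M : ModuleCat.{u} R) (_ : Module.Flat R M) => pd R M)
        F hF le_rfl
    have hX₃ : HasProjectiveDimensionLT S.X₃ (n + 1 + 1) :=
      hS.hasProjectiveDimensionLT_X₃ (n + 1) hX₁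
        (hasProjectiveDimensionLT_of_ge _ n (n + 1 + 1) (by lia))
    have hX₃' : HasProjectiveDimensionLT S.X₃ (n + 1) := by
      rw [← pd_le_iff, hn]
      refine le_sSup ⟨?_, S.X₃, rfl⟩
      have : pd R S.X₃ ≤ (n + 1 : ℕ) := (pd_le_iff R _ _).2 hX₃
      exact (this.trans_lt (ENat.natCast_lt_top _)).ne
    exact hS.hasProjectiveDimensionLT_X₁ n hX₂ hX₃'
  · rw [h, ← hn, not_le]
    exact_mod_cast (by lia : n - 1 < n)
end

section
/- If R is a subring retract of a commutative ring S (there are ring homomorphisms ψ: R → S, φ: S → R with φ∘ψ = id_R), then cot.D(R) ≤ cot.D(S); in particular, if S is n-perfect then R is n-perfect. -/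
open CategoryTheory Opposite

open TensorProduct in
lemma aux_flat_ker {R : Type u} [CommRing R] {P M : Type u} [AddCommGroup P] [Module R P]
    [AddCommGroup M] [Module R M] [Module.Flat R P] [Module.Flat R M] (f : P →ₗ[R] M)
    (hf : Function.Surjective f) : Module.Flat R (LinearMap.ker f) := by
  rw [Module.Flat.iff_lTensor_preserves_injective_linearMap]
  intro A B _ _ _ _ g hg
  have h1 : Function.Injective ((LinearMap.ker f).subtype.rTensor A) := by
    have := LinearMap.lTensor_injective_of_exact_of_flat (P := M) f hf
      (LinearMap.ker f).subtype (Submodule.injective_subtype _) f.exact_subtype_ker_map A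
    rwa [LinearMap.lTensor_inj_iff_rTensor_inj] at this
  have h2 : Function.Injective (g.lTensor P) := Module.Flat.lTensor_preserves_injective_linearMap g hg
  have h3 := h2.comp h1
  rw [← LinearMap.coe_comp, LinearMap.lTensor_comp_rTensor, ← LinearMap.rTensor_comp_lTensor,
    LinearMap.coe_comp] at h3
  exact h3.of_comp

lemma aux_subsingleton_iff {R : Type u} [CommRing R] {M : ModuleCat.{u} R}
    (P : ProjectiveResolution M) (N : ModuleCat.{u} R) (n : ℕ) :
    ExtVanish R M N (n + 1) ↔ ∀ f : P.complex.X (n + 1) ⟶ N,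
      P.complex.d (n + 2) (n + 1) ≫ f = 0 → ∃ g : P.complex.X n ⟶ N,
        P.complex.d (n + 1) n ≫ g = f := by
  unfold ExtVanish
  rw [← ModuleCat.isZero_iff_subsingleton, (P.isoExt (R := R) (n + 1) N).isZero_iff,
    ← HomologicalComplex.exactAt_iff_isZero_homology,
    HomologicalComplex.exactAt_iff' _ n (n + 1) (n + 2) (by simp) (by simp),
    ShortComplex.moduleCat_exact_iff]
  rfl

lemma aux_pdLE_iff {R : Type u} [CommRing R] (M : ModuleCat.{u} R) (n : ℕ) :
    pdLE R M n ↔ HasProjectiveDimensionLE M n := by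
  let P : ProjectiveResolution M := projectiveResolution M
  constructor
  · intro h
    refine hasProjectiveDimensionLT_of_enoughInjectives M (n + 1) fun N => ?_
    refine subsingleton_of_forall_eq 0 fun α => ?_
    obtain ⟨f, hf, rfl⟩ := P.extMk_surjective α (n + 2) rfl
    rw [P.extMk_eq_zero_iff _ _ _ _ n rfl]
    exact (aux_subsingleton_iff P N n).1 (h N) f hf
  · intro h N
    rw [aux_subsingleton_iff P]
    intro f hf
    rw [← P.extMk_eq_zero_iff f (n + 2) rfl hf n rfl]
    exact Abelian.Ext.eq_zero_of_hasProjectiveDimensionLT _ (n + 1) le_rfl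

lemma aux_ses {R : Type u} (S : Type u) [CommRing R] [CommRing S] [Algebra R S]
    {P M : Type u} [AddCommGroup P] [Module R P] [AddCommGroup M] [Module R M]
    [Module.Flat R M] (f : P →ₗ[R] M) (hf : Function.Surjective f) :
    ∃ eq0, (ModuleCat.shortComplexOfCompEqZero ((LinearMap.ker f).subtype.baseChange S)
      (f.baseChange S) eq0).ShortExact := by
  have inj : Function.Injective ((LinearMap.ker f).subtype.lTensor S) :=
    LinearMap.lTensor_injective_of_exact_of_flat (P := M) f hf
      (LinearMap.ker f).subtype (Submodule.injective_subtype _) f.exact_subtype_ker_map S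
  have ex : Function.Exact ((LinearMap.ker f).subtype.lTensor S) (f.lTensor S) :=
    lTensor_exact S f.exact_subtype_ker_map hf
  refine ⟨?_, ModuleCat.shortComplex_shortExact _ ex inj (LinearMap.lTensor_surjective S hf)⟩
  ext x
  simp

open TensorProduct in
lemma aux_descend {R S : Type u} [CommRing R] [CommRing S] [Algebra R S] [Algebra S R]
    [IsScalarTower R S R] (n : ℕ) (M : Type u) [AddCommGroup M] [Module R M] [Module.Flat R M]
    (h : HasProjectiveDimensionLE (ModuleCat.of S (S ⊗[R] M)) n) :
    HasProjectiveDimensionLE (ModuleCat.of R M) n := by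
  induction n generalizing M with
  | zero =>
    rw [← projective_iff_hasProjectiveDimensionLE_zero, ← IsProjective.iff_projective] at h ⊢
    have : Module.Projective S (S ⊗[R] M) := h
    exact Module.Projective.of_equiv
      (AlgebraTensorModule.cancelBaseChange R S R R M ≪≫ₗ TensorProduct.lid R M)
  | succ n ih =>
    let f : (M →₀ R) →ₗ[R] M := Finsupp.linearCombination R id
    have hf : Function.Surjective f := Finsupp.linearCombination_id_surjective R M
    have := aux_flat_ker f hf
    have T := LinearMap.shortExact_shortComplexKer hf
    have pT : Projective f.shortComplexKer.X₂ :=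
      ModuleCat.projective_of_categoryTheory_projective _
    obtain ⟨eq0, T'⟩ := aux_ses S f hf
    refine (T.hasProjectiveDimensionLT_X₃_iff n pT).2 (ih _ ?_)
    refine (T'.hasProjectiveDimensionLT_X₃_iff n ?_).1 h
    rw [← IsProjective.iff_projective]
    exact inferInstanceAs (Module.Projective S (S ⊗[R] (M →₀ R)))

lemma aux_pd_le_iff {R : Type u} [CommRing R] (M : ModuleCat.{u} R) (n : ℕ) :
    pd R M ≤ n ↔ HasProjectiveDimensionLE M n := by
  constructor
  · intro h
    have hlt : pd R M < ((n + 1 : ℕ) : ℕ∞) := lt_of_le_of_lt h (by exact_mod_cast Nat.lt_succ_self n)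
    obtain ⟨_, ⟨m, hm, rfl⟩, hmn⟩ := sInf_lt_iff.1 hlt
    have hmn : m < n + 1 := by exact_mod_cast hmn
    have := (aux_pdLE_iff M m).1 hm
    exact hasProjectiveDimensionLT_of_ge M (m + 1) (n + 1) (by omega)
  · intro h
    exact sInf_le ⟨n, (aux_pdLE_iff M n).2 h, rfl⟩

open TensorProduct in
lemma aux_perfect {R S : Type u} [CommRing R] [CommRing S]
    (ψ : R →+* S) (φ : S →+* R) (h : φ.comp ψ = RingHom.id R) (n : ℕ) (hS : IsNPerfect S n) :
    IsNPerfect R n := by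
  intro M hM
  algebraize [ψ]
  let := φ.toAlgebra
  have : IsScalarTower R S R := .of_algebraMap_eq fun r => (DFunLike.congr_fun h r).symm
  exact (aux_pd_le_iff M n).2 (aux_descend (S := S) n M ((aux_pd_le_iff _ n).1
    (hS (ModuleCat.of S (S ⊗[R] M)) (inferInstanceAs (Module.Flat S (S ⊗[R] M))))))

lemma aux_cotD {R : Type u} [CommRing R] (n : ℕ) : cotD R ≤ n ↔ IsNPerfect R n := by
  unfold cotD IsNPerfect
  simp only [iSup_le_iff]

/-- If `R` is a subring retract of `S`, then `cot.D R ≤ cot.D S`; in particular,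
if `S` is `n`-perfect then so is `R`. -/
theorem stmt_15 (R S : Type u) [CommRing R] [CommRing S]
    (ψ : R →+* S) (φ : S →+* R) (h : φ.comp ψ = RingHom.id R) :
    cotD R ≤ cotD S ∧ ∀ n : ℕ, IsNPerfect S n → IsNPerfect R n := by
  refine ⟨?_, aux_perfect ψ φ h⟩
  cases hd : cotD S with
  | top => exact le_top
  | coe n => exact (aux_cotD n).2 (aux_perfect ψ φ h n ((aux_cotD n).1 hd.le))
end
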